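/- Let Γ be a group generated by a finite set S, F the free group on S, and π : F → Γ the induced epimorphism. Call a stability challenge (X_n) for Γ convergent if for every r ∈ ℕ and every subset W of the ball B(r) of radius r in F, the proportion P_{x∈X_n}[ for all w ∈ B(r): w·x = x if and only if w ∈ W ] converges as n → ∞. Then Γ is locally stable if and only if every convergent stability challenge for Γ has a local solution. -/

import Mathlib

open Filter Topology

open scoped Classical

/-- Normalized Hamming metric on `Sym(k)`:
`d_k(σ,τ) = |{i : σ i ≠ τ i}| / k` (which equals `1 - |{i : σ i = τ i}|/k` for `k ≥ 1`). -/
noncomputable def dHam {k : ℕ} (σ τ : Equiv.Perm (Fin k)) : ℝ :=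
  ((Finset.univ.filter fun i => σ i ≠ τ i).card : ℝ) / k

/-- `(φ_n)` is an almost-homomorphism. -/
def IsAlmostHom {Γ : Type*} [Group Γ] (k : ℕ → ℕ)
    (φ : ∀ n, Γ → Equiv.Perm (Fin (k n))) : Prop :=
  ∀ g h : Γ,
    Tendsto (fun n => dHam (φ n g * φ n h) (φ n (g * h))) atTop (𝓝 0)

/-- `(φ_n)` is a partial homomorphism. -/
def IsPartialHom {Γ : Type*} [Group Γ] (k : ℕ → ℕ)
    (φ : ∀ n, Γ → Equiv.Perm (Fin (k n))) : Prop :=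
  ∀ g h : Γ, ∀ᶠ n in atTop, φ n (g * h) = φ n g * φ n h

/-- `(φ_n)` is separating. -/
def IsSeparating {Γ : Type*} [Group Γ] (k : ℕ → ℕ)
    (φ : ∀ n, Γ → Equiv.Perm (Fin (k n))) : Prop :=
  ∀ g : Γ, g ≠ 1 → Tendsto (fun n => dHam (φ n g) 1) atTop (𝓝 1)

/-- `(φ_n)` is a sequence of genuine homomorphisms. -/
def IsHomSeq {Γ : Type*} [Group Γ] (k : ℕ → ℕ)
    (φ : ∀ n, Γ → Equiv.Perm (Fin (k n))) : Prop :=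
  ∀ n, ∀ g h : Γ, φ n (g * h) = φ n g * φ n h

/-- `(ψ_n)` is asymptotically close to `(φ_n)`: for every `g`, `d_{k_n}(φ_n g, ψ_n g) → 0`. -/
def CloseSeq {Γ : Type*} [Group Γ] (k : ℕ → ℕ)
    (φ ψ : ∀ n, Γ → Equiv.Perm (Fin (k n))) : Prop :=
  ∀ g : Γ, Tendsto (fun n => dHam (φ n g) (ψ n g)) atTop (𝓝 0)

/-- `Γ` is locally stable. -/
def IsLocallyStable (Γ : Type*) [Group Γ] : Prop :=
  ∀ (k : ℕ → ℕ), (∀ n, 0 < k n) →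
    ∀ φ : ∀ n, Γ → Equiv.Perm (Fin (k n)), IsAlmostHom k φ →
      ∃ ψ : ∀ n, Γ → Equiv.Perm (Fin (k n)), IsPartialHom k ψ ∧ CloseSeq k φ ψ

/-- `Γ` is weakly locally stable. -/
def IsWeaklyLocallyStable (Γ : Type*) [Group Γ] : Prop :=
  ∀ (k : ℕ → ℕ), (∀ n, 0 < k n) →
    ∀ φ : ∀ n, Γ → Equiv.Perm (Fin (k n)), IsAlmostHom k φ → IsSeparating k φ →
      ∃ ψ : ∀ n, Γ → Equiv.Perm (Fin (k n)), IsPartialHom k ψ ∧ CloseSeq k φ ψ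

/-- `Γ` is stable (in permutations). -/
def IsStable (Γ : Type*) [Group Γ] : Prop :=
  ∀ (k : ℕ → ℕ), (∀ n, 0 < k n) →
    ∀ φ : ∀ n, Γ → Equiv.Perm (Fin (k n)), IsAlmostHom k φ →
      ∃ ψ : ∀ n, Γ → Equiv.Perm (Fin (k n)), IsHomSeq k ψ ∧ CloseSeq k φ ψ

/-- `Γ` is weakly stable. -/
def IsWeaklyStable (Γ : Type*) [Group Γ] : Prop :=
  ∀ (k : ℕ → ℕ), (∀ n, 0 < k n) →
    ∀ φ : ∀ n, Γ → Equiv.Perm (Fin (k n)), IsAlmostHom k φ → IsSeparating k φ →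
      ∃ ψ : ∀ n, Γ → Equiv.Perm (Fin (k n)), IsHomSeq k ψ ∧ CloseSeq k φ ψ

/-- `Γ` is sofic: it admits a separating almost-homomorphism. -/
def IsSofic (Γ : Type*) [Group Γ] : Prop :=
  ∃ (k : ℕ → ℕ), (∀ n, 0 < k n) ∧
    ∃ φ : ∀ n, Γ → Equiv.Perm (Fin (k n)), IsAlmostHom k φ ∧ IsSeparating k φ

/-- `Γ` is LEF: it admits a separating partial homomorphism. -/
def IsLEF (Γ : Type*) [Group Γ] : Prop :=
  ∃ (k : ℕ → ℕ), (∀ n, 0 < k n) ∧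
    ∃ φ : ∀ n, Γ → Equiv.Perm (Fin (k n)), IsPartialHom k φ ∧ IsSeparating k φ

/-- Proportion of points moved by a permutation of `Fin k`. -/
noncomputable def probMoved {k : ℕ} (σ : Equiv.Perm (Fin k)) : ℝ :=
  ((Finset.univ.filter fun x => σ x ≠ x).card : ℝ) / k

/-- `‖f‖_gen` for a bijection `f` between two finite `F`-sets (both modelled on `Fin k`),
where `F` is the free group on the finite set `ι`. -/
noncomputable def normGen {ι : Type} [Fintype ι] {k : ℕ}
    (a b : FreeGroup ι →* Equiv.Perm (Fin k)) (f : Equiv.Perm (Fin k)) : ℝ :=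
  (1 / (Fintype.card ι : ℝ)) * ∑ i : ι,
    ((Finset.univ.filter fun x =>
        f (a (FreeGroup.of i) x) ≠ b (FreeGroup.of i) (f x)).card : ℝ) / k

/-- `d_gen(X,Y)`: the minimal value of `‖f‖_gen` over bijections `f : X → Y`. -/
noncomputable def dGen {ι : Type} [Fintype ι] {k : ℕ}
    (a b : FreeGroup ι →* Equiv.Perm (Fin k)) : ℝ :=
  sInf (Set.range fun f : Equiv.Perm (Fin k) => normGen a b f)

/-- A stability challenge for `Γ` (marked by `π : F → Γ`): a sequence of finite `F`-sets
such that every `r ∈ ker π` asymptotically moves a vanishing proportion of points. -/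
def IsStabilityChallenge {ι : Type} [Fintype ι] {Γ : Type*} [Group Γ]
    (π : FreeGroup ι →* Γ) (k : ℕ → ℕ)
    (a : ∀ n, FreeGroup ι →* Equiv.Perm (Fin (k n))) : Prop :=
  ∀ r ∈ π.ker, Tendsto (fun n => probMoved (a n r)) atTop (𝓝 0)

/-- The stability challenge is separating: every `w ∉ ker π` asymptotically moves almost
all points. -/
def IsSeparatingChallenge {ι : Type} [Fintype ι] {Γ : Type*} [Group Γ]
    (π : FreeGroup ι →* Γ) (k : ℕ → ℕ)
    (a : ∀ n, FreeGroup ι →* Equiv.Perm (Fin (k n))) : Prop :=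
  ∀ w : FreeGroup ι, w ∉ π.ker → Tendsto (fun n => probMoved (a n w)) atTop (𝓝 1)

/-- `(Y_n)` is a local `Γ`-set: every `r ∈ ker π` acts trivially for all large `n`. -/
def IsLocalGammaSet {ι : Type} [Fintype ι] {Γ : Type*} [Group Γ]
    (π : FreeGroup ι →* Γ) (k : ℕ → ℕ)
    (b : ∀ n, FreeGroup ι →* Equiv.Perm (Fin (k n))) : Prop :=
  ∀ r ∈ π.ker, ∀ᶠ n in atTop, b n r = 1

/-- `(Y_n)` is a local solution to the stability challenge `(X_n)`: it is a local
`Γ`-set of the same sizes with `d_gen(X_n, Y_n) → 0`. -/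
def IsLocalSolution {ι : Type} [Fintype ι] {Γ : Type*} [Group Γ]
    (π : FreeGroup ι →* Γ) (k : ℕ → ℕ)
    (a b : ∀ n, FreeGroup ι →* Equiv.Perm (Fin (k n))) : Prop :=
  IsLocalGammaSet π k b ∧ Tendsto (fun n => dGen (a n) (b n)) atTop (𝓝 0)

/-- The stability challenge `(X_n)` is convergent: for every radius `r` and every
`W ⊆ B(r)`, the proportion of points whose `B(r)`-fixing pattern is exactly `W`
converges. -/
def IsConvergentChallenge {ι : Type} [Fintype ι] {Γ : Type*} [Group Γ]
    (π : FreeGroup ι →* Γ) (k : ℕ → ℕ)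
    (a : ∀ n, FreeGroup ι →* Equiv.Perm (Fin (k n))) : Prop :=
  IsStabilityChallenge π k a ∧
    ∀ (r : ℕ) (W : Set (FreeGroup ι)), (∀ w ∈ W, w.toWord.length ≤ r) →
      ∃ L : ℝ, Tendsto (fun n =>
          ((Finset.univ.filter fun x : Fin (k n) =>
              ∀ w : FreeGroup ι, w.toWord.length ≤ r → (a n w x = x ↔ w ∈ W)).card : ℝ)
            / (k n)) atTop (𝓝 L)

section Hamming

variable {k : ℕ}

theorem dHam_nonneg (σ τ : Equiv.Perm (Fin k)) : 0 ≤ dHam σ τ := by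
  unfold dHam; positivity

theorem dHam_self (σ : Equiv.Perm (Fin k)) : dHam σ σ = 0 := by
  simp [dHam]

theorem dHam_comm (σ τ : Equiv.Perm (Fin k)) : dHam σ τ = dHam τ σ := by
  simp only [dHam, ne_comm]

theorem dHam_triangle (σ τ ρ : Equiv.Perm (Fin k)) : dHam σ ρ ≤ dHam σ τ + dHam τ ρ := by
  unfold dHam
  rw [← add_div]
  gcongr
  norm_cast
  refine (Finset.card_le_card fun i => ?_).trans (Finset.card_union_le _ _)
  simp only [Finset.mem_union, Finset.mem_filter, Finset.mem_univ, true_and]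
  intro h
  by_contra! h'
  exact h (h'.1.trans h'.2)

theorem dHam_mul_left (ρ σ τ : Equiv.Perm (Fin k)) : dHam (ρ * σ) (ρ * τ) = dHam σ τ := by
  simp [dHam]

theorem dHam_mul_right (σ τ ρ : Equiv.Perm (Fin k)) : dHam (σ * ρ) (τ * ρ) = dHam σ τ := by
  unfold dHam
  congr 2
  refine Finset.card_equiv ρ fun i => ?_
  rw [Finset.mem_filter, Finset.mem_filter]
  simp

end Hamming

section Asymptotic

variable {k : ℕ → ℕ}

/-- Two sequences of permutations are asymptotically equal if their Hamming distance
tends to zero. -/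
def AsympEq (σ τ : ∀ n, Equiv.Perm (Fin (k n))) : Prop :=
  Tendsto (fun n => dHam (σ n) (τ n)) atTop (𝓝 0)

namespace AsympEq

variable {σ τ ρ σ' τ' : ∀ n, Equiv.Perm (Fin (k n))}

theorem refl (σ : ∀ n, Equiv.Perm (Fin (k n))) : AsympEq σ σ := by
  simp [AsympEq, dHam_self]

theorem symm (h : AsympEq σ τ) : AsympEq τ σ := by
  simpa only [AsympEq, dHam_comm] using h

theorem trans (h : AsympEq σ τ) (h' : AsympEq τ ρ) : AsympEq σ ρ := by
  refine squeeze_zero (fun n => dHam_nonneg _ _) (fun n => dHam_triangle _ (τ n) _) ?_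
  simpa using Tendsto.add h h'

theorem mul_left (ρ : ∀ n, Equiv.Perm (Fin (k n))) (h : AsympEq σ τ) :
    AsympEq (fun n => ρ n * σ n) (fun n => ρ n * τ n) := by
  simpa only [AsympEq, dHam_mul_left] using h

theorem mul_right (h : AsympEq σ τ) (ρ : ∀ n, Equiv.Perm (Fin (k n))) :
    AsympEq (fun n => σ n * ρ n) (fun n => τ n * ρ n) := by
  simpa only [AsympEq, dHam_mul_right] using h

theorem mul (h : AsympEq σ τ) (h' : AsympEq σ' τ') :
    AsympEq (fun n => σ n * σ' n) (fun n => τ n * τ' n) :=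
  (h.mul_right σ').trans (h'.mul_left τ)

theorem inv (h : AsympEq σ τ) : AsympEq (fun n => (σ n)⁻¹) (fun n => (τ n)⁻¹) := by
  simpa using ((h.mul_left fun n => (σ n)⁻¹).mul_right fun n => (τ n)⁻¹).symm

end AsympEq

variable {Γ : Type*} [Group Γ] {φ : ∀ n, Γ → Equiv.Perm (Fin (k n))}

theorem IsAlmostHom.map_one (hφ : IsAlmostHom k φ) : AsympEq (fun n => φ n 1) (fun _ => 1) := by
  have h : AsympEq (fun n => φ n 1 * φ n 1) (fun n => φ n 1) := by
    simpa [AsympEq] using hφ 1 1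
  simpa using h.mul_left fun n => (φ n 1)⁻¹

theorem IsAlmostHom.map_inv (hφ : IsAlmostHom k φ) (g : Γ) :
    AsympEq (fun n => (φ n g)⁻¹) (fun n => φ n g⁻¹) := by
  have h : AsympEq (fun n => φ n g * φ n g⁻¹) (fun _ => 1) :=
    AsympEq.trans (by simpa [AsympEq] using hφ g g⁻¹) hφ.map_one
  simpa using (h.mul_left fun n => (φ n g)⁻¹).symm

theorem IsPartialHom.map_one (hφ : IsPartialHom k φ) : ∀ᶠ n in atTop, φ n 1 = 1 := by
  filter_upwards [hφ 1 1] with n hn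
  simpa using hn

theorem IsPartialHom.map_inv (hφ : IsPartialHom k φ) (g : Γ) :
    ∀ᶠ n in atTop, φ n g⁻¹ = (φ n g)⁻¹ := by
  filter_upwards [hφ g g⁻¹, hφ.map_one] with n hn h1
  rw [mul_inv_cancel, h1] at hn
  exact eq_inv_of_mul_eq_one_right hn.symm

variable {ι : Type*} {π : FreeGroup ι →* Γ} {a : ∀ n, FreeGroup ι →* Equiv.Perm (Fin (k n))}

/-- Agreement on the generators propagates to all words. -/
theorem IsAlmostHom.asympEq_of_generators (hφ : IsAlmostHom k φ)
    (h : ∀ i, AsympEq (fun n => a n (FreeGroup.of i)) (fun n => φ n (π (FreeGroup.of i))))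
    (w : FreeGroup ι) : AsympEq (fun n => a n w) (fun n => φ n (π w)) := by
  induction w using FreeGroup.induction_on with
  | C1 => simpa using hφ.map_one.symm
  | of i => exact h i
  | inv_of i hi => simpa using hi.inv.trans (hφ.map_inv _)
  | mul x y hx hy => simpa using (hx.mul hy).trans (hφ _ _)

theorem IsPartialHom.eventually_eq_of_generators (hφ : IsPartialHom k φ)
    (h : ∀ i n, a n (FreeGroup.of i) = φ n (π (FreeGroup.of i)))
    (w : FreeGroup ι) : ∀ᶠ n in atTop, a n w = φ n (π w) := by
  induction w using FreeGroup.induction_on with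
  | C1 =>
    filter_upwards [hφ.map_one] with n hn
    simp [hn]
  | of i => exact .of_forall (h i)
  | inv_of i hi =>
    filter_upwards [hi, hφ.map_inv (π (FreeGroup.of i))] with n hn hn'
    rw [_root_.map_inv, _root_.map_inv, hn, hn']
  | mul x y hx hy =>
    filter_upwards [hx, hy, hφ (π x) (π y)] with n hnx hny hn
    rw [map_mul, map_mul, hnx, hny, hn]

end Asymptotic

theorem exists_tendsto_atTop_eventually_diag {P : ℕ → ℕ → Prop} (hP : ∀ m, ∀ᶠ n in atTop, P m n) :
    ∃ u : ℕ → ℕ, Tendsto u atTop atTop ∧ ∀ᶠ n in atTop, P (u n) n := by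
  refine ⟨fun n => Nat.findGreatest (fun m => P m n) n, ?_, ?_⟩
  · refine tendsto_atTop.2 fun m => ?_
    filter_upwards [hP m, eventually_ge_atTop m] with n hn hmn
    exact Nat.le_findGreatest hmn hn
  · filter_upwards [hP 0] with n hn
    exact Nat.findGreatest_spec (P := fun m => P m n) (Nat.zero_le n) hn

section Ball

variable {ι : Type} [Fintype ι]

theorem finite_freeGroup_ball (r : ℕ) : {w : FreeGroup ι | w.toWord.length ≤ r}.Finite :=
  (List.finite_length_le (ι × Bool) r).preimage FreeGroup.toWord_injective.injOn

/-- The proportion of points whose fixing pattern on the ball of radius `r` is `W`. -/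
noncomputable def patternProb {ι : Type} {k : ℕ} (a : FreeGroup ι →* Equiv.Perm (Fin k)) (r : ℕ)
    (W : Set (FreeGroup ι)) : ℝ :=
  ((Finset.univ.filter fun x : Fin k =>
    ∀ w : FreeGroup ι, w.toWord.length ≤ r → (a w x = x ↔ w ∈ W)).card : ℝ) / k

theorem patternProb_mem_Icc {ι : Type} {k : ℕ} (a : FreeGroup ι →* Equiv.Perm (Fin k)) (r : ℕ)
    (W : Set (FreeGroup ι)) : patternProb a r W ∈ Set.Icc (0 : ℝ) 1 := by
  refine ⟨by unfold patternProb; positivity, div_le_one_of_le₀ ?_ (by positivity)⟩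
  exact_mod_cast (Finset.card_le_univ _).trans (Fintype.card_fin k).le

variable {Γ : Type*} [Group Γ] {π : FreeGroup ι →* Γ} {k : ℕ → ℕ}
  {a : ∀ n, FreeGroup ι →* Equiv.Perm (Fin (k n))}

theorem isStabilityChallenge_iff_asympEq :
    IsStabilityChallenge π k a ↔ ∀ r ∈ π.ker, AsympEq (fun n => a n r) (fun _ => 1) :=
  Iff.rfl

theorem IsStabilityChallenge.comp (ha : IsStabilityChallenge π k a) {u : ℕ → ℕ}
    (hu : Tendsto u atTop atTop) :
    IsStabilityChallenge π (fun n => k (u n)) (fun n => a (u n)) :=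
  fun r hr => (ha r hr).comp hu

/-- Every stability challenge has a convergent subsequence. -/
theorem IsStabilityChallenge.exists_convergent_subseq (ha : IsStabilityChallenge π k a) :
    ∃ u : ℕ → ℕ, StrictMono u ∧
      IsConvergentChallenge π (fun n => k (u n)) (fun n => a (u n)) := by
  let stat : ℕ → ℕ × Finset (FreeGroup ι) → ℝ := fun n p => patternProb (a n) p.1 p.2
  have hcompact : IsCompact (Set.univ.pi fun _ : ℕ × Finset (FreeGroup ι) => Set.Icc (0 : ℝ) 1) :=
    isCompact_univ_pi fun _ => isCompact_Icc
  obtain ⟨L, -, u, hu, hL⟩ := hcompact.tendsto_subseq (x := stat)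
    fun n p _ => patternProb_mem_Icc _ _ _
  refine ⟨u, hu, ha.comp hu.tendsto_atTop, fun r W hW => ?_⟩
  have hfin : W.Finite := (finite_freeGroup_ball r).subset hW
  refine ⟨L (r, hfin.toFinset), ?_⟩
  simpa [stat, Function.comp_def, patternProb] using (tendsto_pi_nhds.1 hL) (r, hfin.toFinset)

theorem dGen_nonneg {k : ℕ} (a b : FreeGroup ι →* Equiv.Perm (Fin k)) : 0 ≤ dGen a b := by
  refine Real.sInf_nonneg ?_
  rintro _ ⟨f, rfl⟩
  unfold normGen
  positivity

theorem dGen_le_normGen {k : ℕ} (a b : FreeGroup ι →* Equiv.Perm (Fin k))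
    (f : Equiv.Perm (Fin k)) : dGen a b ≤ normGen a b f :=
  csInf_le (Set.finite_range _).bddBelow ⟨f, rfl⟩

theorem exists_normGen_eq_dGen {k : ℕ} (a b : FreeGroup ι →* Equiv.Perm (Fin k)) :
    ∃ f, normGen a b f = dGen a b :=
  (Set.range_nonempty _).csInf_mem (Set.finite_range _)

theorem normGen_eq_sum_dHam {k : ℕ} (a b : FreeGroup ι →* Equiv.Perm (Fin k))
    (f : Equiv.Perm (Fin k)) :
    normGen a b f = (1 / (Fintype.card ι : ℝ)) * ∑ i : ι,
      dHam (f * a (FreeGroup.of i)) (b (FreeGroup.of i) * f) := rfl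

theorem dHam_conj_le_normGen {k : ℕ} (a b : FreeGroup ι →* Equiv.Perm (Fin k))
    (f : Equiv.Perm (Fin k)) (i : ι) :
    dHam (a (FreeGroup.of i)) (f⁻¹ * b (FreeGroup.of i) * f) ≤
      Fintype.card ι * normGen a b f := by
  have : Nonempty ι := ⟨i⟩
  have hc : (Fintype.card ι : ℝ) ≠ 0 := by exact_mod_cast Fintype.card_ne_zero
  rw [normGen_eq_sum_dHam, ← mul_assoc, mul_one_div_cancel hc, one_mul,
    ← dHam_mul_left f, ← mul_assoc, mul_inv_cancel_left]
  exact Finset.single_le_sum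
    (f := fun i => dHam (f * a (FreeGroup.of i)) (b (FreeGroup.of i) * f))
    (fun j _ => dHam_nonneg _ _) (Finset.mem_univ i)

/-- If convergent challenges have local solutions, then all stability challenges do. -/
theorem IsStabilityChallenge.exists_localSolution
    (H : ∀ k : ℕ → ℕ, (∀ n, 0 < k n) → ∀ a : ∀ n, FreeGroup ι →* Equiv.Perm (Fin (k n)),
      IsConvergentChallenge π k a → ∃ b, IsLocalSolution π k a b)
    (hk : ∀ n, 0 < k n) (ha : IsStabilityChallenge π k a) :
    ∃ b, IsLocalSolution π k a b := by
  let Q : ℕ → ∀ n, (FreeGroup ι →* Equiv.Perm (Fin (k n))) → Prop := fun m n b =>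
    dGen (a n) b < 1 / ((m : ℝ) + 1) ∧ ∀ r ∈ π.ker, r.toWord.length ≤ m → b r = 1
  have hQ : ∀ m, ∀ᶠ n in atTop, ∃ b, Q m n b := by
    intro m
    by_contra hm
    obtain ⟨u, hu, hum⟩ := extraction_of_frequently_atTop (not_eventually.1 hm)
    obtain ⟨v, hv, hconv⟩ := (ha.comp hu.tendsto_atTop).exists_convergent_subseq
    obtain ⟨b, hb, hb'⟩ := H _ (fun n => hk _) _ hconv
    have hball : ∀ᶠ n in atTop, ∀ r ∈ {w : FreeGroup ι | w.toWord.length ≤ m},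
        r ∈ π.ker → b n r = 1 := by
      refine (eventually_all_finite (finite_freeGroup_ball m)).2 fun r _ => ?_
      by_cases hr : r ∈ π.ker
      · filter_upwards [hb r hr] with n hn _ using hn
      · exact .of_forall fun n h => absurd h hr
    have hlt := hb'.eventually_lt_const (Nat.one_div_pos_of_nat (α := ℝ) (n := m))
    obtain ⟨n, h1, h2⟩ := (hball.and hlt).exists
    exact hum (v n) ⟨b n, h2, fun r hr hrm => h1 r hrm hr⟩
  obtain ⟨u, hu, huQ⟩ := exists_tendsto_atTop_eventually_diag hQ
  have hchoose : ∀ n, ∃ b, (∃ b', Q (u n) n b') → Q (u n) n b := fun n => by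
    by_cases h : ∃ b', Q (u n) n b'
    · exact h.imp fun b hb _ => hb
    · exact ⟨1, fun h' => absurd h' h⟩
  choose b hb using hchoose
  refine ⟨b, fun r hr => ?_, ?_⟩
  · filter_upwards [huQ, hu.eventually_ge_atTop r.toWord.length] with n hn hrn
    exact (hb n hn).2 r hr hrn
  · refine squeeze_zero' (.of_forall fun n => dGen_nonneg _ _) ?_
      ((tendsto_one_div_add_atTop_nhds_zero_nat (𝕜 := ℝ)).comp hu)
    filter_upwards [huQ] with n hn
    exact (hb n hn).1.le

/-- Over a group marked by an epimorphism from a free group, local stability means that every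
stability challenge has a local solution. -/
theorem isLocallyStable_iff_forall_challenge (hπ : Function.Surjective π) :
    IsLocallyStable Γ ↔
      ∀ k : ℕ → ℕ, (∀ n, 0 < k n) → ∀ a : ∀ n, FreeGroup ι →* Equiv.Perm (Fin (k n)),
        IsStabilityChallenge π k a → ∃ b, IsLocalSolution π k a b := by
  choose w hw using hπ
  constructor
  · intro H k hk a ha
    have key : ∀ x y, π x = π y → AsympEq (fun n => a n x) (fun n => a n y) := by
      intro x y hxy
      have h : AsympEq (fun n => a n (x * y⁻¹)) (fun _ => 1) :=
        isStabilityChallenge_iff_asympEq.1 ha (x * y⁻¹) (by simp [MonoidHom.mem_ker, hxy])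
      simpa using h.mul_right fun n => a n y
    obtain ⟨ψ, hψ, hclose⟩ := H k hk (fun n g => a n (w g)) fun g h => by
      simpa [AsympEq] using key (w g * w h) (w (g * h)) (by simp [hw])
    let b : ∀ n, FreeGroup ι →* Equiv.Perm (Fin (k n)) := fun n =>
      FreeGroup.lift fun i => ψ n (π (FreeGroup.of i))
    refine ⟨b, fun r hr => ?_, ?_⟩
    · filter_upwards [hψ.eventually_eq_of_generators (a := b) (π := π) (by simp [b]) r,
        hψ.map_one] with n hn h1
      rw [hn, MonoidHom.mem_ker.1 hr, h1]
    · refine squeeze_zero (fun n => dGen_nonneg _ _) (fun n => dGen_le_normGen _ _ 1) ?_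
      simp only [normGen_eq_sum_dHam, one_mul, mul_one]
      have hgen : ∀ i, AsympEq (fun n => a n (FreeGroup.of i)) (fun n => b n (FreeGroup.of i)) :=
        fun i => (key _ (w (π (FreeGroup.of i))) (hw _).symm).trans
          (by simpa [b, AsympEq] using hclose (π (FreeGroup.of i)))
      simpa using (tendsto_finsetSum Finset.univ fun i _ => hgen i).const_mul
        (1 / (Fintype.card ι : ℝ))
  · intro H k hk φ hφ
    let a : ∀ n, FreeGroup ι →* Equiv.Perm (Fin (k n)) := fun n =>
      FreeGroup.lift fun i => φ n (π (FreeGroup.of i))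
    have haφ : ∀ x, AsympEq (fun n => a n x) (fun n => φ n (π x)) :=
      hφ.asympEq_of_generators fun i => by
        simp only [a, FreeGroup.lift_apply_of]
        exact AsympEq.refl _
    have ha : IsStabilityChallenge π k a := by
      refine isStabilityChallenge_iff_asympEq.2 fun r hr => ?_
      have h := haφ r
      rw [MonoidHom.mem_ker.1 hr] at h
      exact h.trans hφ.map_one
    obtain ⟨b, hb, hab⟩ := H k hk a ha
    choose f hf using fun n => exists_normGen_eq_dGen (a n) (b n)
    let c : ∀ n, FreeGroup ι →* Equiv.Perm (Fin (k n)) := fun n =>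
      (MulAut.conj (f n)⁻¹).toMonoidHom.comp (b n)
    have hc : ∀ n x, c n x = (f n)⁻¹ * b n x * f n := fun n x => by simp [c]
    have hac : ∀ x, AsympEq (fun n => a n x) (fun n => c n x) := by
      refine IsAlmostHom.asympEq_of_generators (π := MonoidHom.id _) (φ := fun n x => c n x)
        (fun g h => by simp [dHam_self]) fun i => ?_
      refine squeeze_zero (fun n => dHam_nonneg _ _) (fun n => ?_)
        (by simpa using hab.const_mul (Fintype.card ι : ℝ))
      simpa only [MonoidHom.id_apply, hc, ← hf n] using dHam_conj_le_normGen (a n) (b n) (f n) i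
    refine ⟨fun n g => c n (w g), fun g h => ?_, fun g => ?_⟩
    · filter_upwards [hb (w (g * h) * (w g * w h)⁻¹) (by simp [MonoidHom.mem_ker, hw])] with n hn
      have hn' : b n (w (g * h)) = b n (w g * w h) := by
        rwa [map_mul, map_inv, mul_inv_eq_one] at hn
      rw [← map_mul, hc, hc, hn']
    · have h := (haφ (w g)).symm.trans (hac (w g))
      rwa [hw] at h

end Ball

/-- `Γ` is locally stable iff every convergent stability challenge for `Γ` has a local
solution. -/
theorem locallyStable_iff_convergent_challenges (Γ : Type) [Group Γ] (S : Finset Γ)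
    (hS : Subgroup.closure (S : Set Γ) = ⊤) :
    IsLocallyStable Γ ↔
      ∀ (k : ℕ → ℕ), (∀ n, 0 < k n) →
        ∀ a : ∀ n, FreeGroup ↥S →* Equiv.Perm (Fin (k n)),
          IsConvergentChallenge (FreeGroup.lift fun s : ↥S => (s : Γ)) k a →
          ∃ b, IsLocalSolution (FreeGroup.lift fun s : ↥S => (s : Γ)) k a b := by
  have hπ : Function.Surjective (FreeGroup.lift fun s : ↥S => (s : Γ)) := by
    rw [← MonoidHom.range_eq_top, FreeGroup.range_lift_eq_closure]
    simpa using hS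
  rw [isLocallyStable_iff_forall_challenge hπ]
  exact ⟨fun H k hk a ha => H k hk a ha.1,
    fun H k hk a ha => ha.exists_localSolution H hk⟩
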